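/- Let K_1 = (1/2)·[[√2,0],[0,1],[0,1],[0,0]] and K_2 = (1/2)·[[0,0],[1,0],[1,0],[0,√2]] be 4×2 complex matrices. Then (i) K_1†K_1 + K_2†K_2 = 1_2, and (ii) for every equatorial state ψ_φ = (|0⟩ + e^{iφ}|1⟩)/√2 with φ ∈ ℝ, writing E(ρ) = K_1 ρ K_1† + K_2 ρ K_2†, each single-clone fidelity satisfies ⟨ψ_φ| tr_B[E(|ψ_φ⟩⟨ψ_φ|)] |ψ_φ⟩ = ⟨ψ_φ| tr_A[E(|ψ_φ⟩⟨ψ_φ|)] |ψ_φ⟩ = 1/2 + √2/4. -/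

import Mathlib

open Matrix

noncomputable section

/-- Encode a pair `(a,b) ∈ {0,1}²` as the row index `2a+b ∈ Fin 4`. -/
def pr (p : Fin 2 × Fin 2) : Fin 4 := ⟨2 * p.1.val + p.2.val, by omega⟩

/-- The rank-one projector `|φ⟩⟨φ|`. -/
def outer {d : ℕ} (φ : Fin d → ℂ) : Matrix (Fin d) (Fin d) ℂ :=
  Matrix.of fun i j => φ i * star (φ j)

/-- Partial trace over the second (B) output qubit. -/
def trB (M : Matrix (Fin 2 × Fin 2) (Fin 2 × Fin 2) ℂ) : Matrix (Fin 2) (Fin 2) ℂ :=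
  Matrix.of fun a a' => ∑ b : Fin 2, M (a, b) (a', b)

/-- Partial trace over the first (A) output qubit. -/
def trA (M : Matrix (Fin 2 × Fin 2) (Fin 2 × Fin 2) ℂ) : Matrix (Fin 2) (Fin 2) ℂ :=
  Matrix.of fun b b' => ∑ a : Fin 2, M (a, b) (a, b')

/-- `⟨ψ| M |ψ⟩`. -/
def fid {d : ℕ} (ψ : Fin d → ℂ) (M : Matrix (Fin d) (Fin d) ℂ) : ℂ :=
  ∑ i, ∑ j, star (ψ i) * M i j * ψ j

/-- First Kraus operator of the phase-covariant 1→2 cloner. -/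
def K₁ : Matrix (Fin 2 × Fin 2) (Fin 2) ℂ :=
  Matrix.of fun p j =>
    (1 / 2 : ℂ) * !![((Real.sqrt 2 : ℝ) : ℂ), 0; 0, 1; 0, 1; 0, 0] (pr p) j

/-- Second Kraus operator of the phase-covariant 1→2 cloner. -/
def K₂ : Matrix (Fin 2 × Fin 2) (Fin 2) ℂ :=
  Matrix.of fun p j =>
    (1 / 2 : ℂ) * !![(0 : ℂ), 0; 1, 0; 1, 0; 0, ((Real.sqrt 2 : ℝ) : ℂ)] (pr p) j

/-- The equatorial state `ψ_φ = (|0⟩ + e^{iφ}|1⟩)/√2`. -/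
def eqState (φ : ℝ) : Fin 2 → ℂ :=
  ![((1 / Real.sqrt 2 : ℝ) : ℂ),
    Complex.exp (Complex.I * (φ : ℂ)) * ((1 / Real.sqrt 2 : ℝ) : ℂ)]

/-- The channel `E(ρ) = K₁ ρ K₁† + K₂ ρ K₂†` applied to `|ψ⟩⟨ψ|`. -/
def Eout (ψ : Fin 2 → ℂ) : Matrix (Fin 2 × Fin 2) (Fin 2 × Fin 2) ℂ :=
  K₁ * outer ψ * K₁ᴴ + K₂ * outer ψ * K₂ᴴ

theorem K₁_apply (p : Fin 2 × Fin 2) (j : Fin 2) :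
    K₁ p j = (1 / 2 : ℂ) * ![![![((Real.sqrt 2 : ℝ) : ℂ), 0], ![0, 1]],
      ![![0, 1], ![0, 0]]] p.1 p.2 j := by
  obtain ⟨a, b⟩ := p
  fin_cases a <;> fin_cases b <;> fin_cases j <;> simp [K₁, pr]

theorem K₂_apply (p : Fin 2 × Fin 2) (j : Fin 2) :
    K₂ p j = (1 / 2 : ℂ) * ![![![0, 0], ![1, 0]],
      ![![1, 0], ![0, ((Real.sqrt 2 : ℝ) : ℂ)]]] p.1 p.2 j := by
  obtain ⟨a, b⟩ := p
  fin_cases a <;> fin_cases b <;> fin_cases j <;> simp [K₂, pr]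

theorem ofReal_sqrt_two_sq : ((Real.sqrt 2 : ℝ) : ℂ) ^ 2 = 2 := by
  exact_mod_cast Real.sq_sqrt (by norm_num : (0 : ℝ) ≤ 2)

theorem eqState_eq (φ : ℝ) : eqState φ =
    ![((Real.sqrt 2 : ℝ) : ℂ) / 2,
      Complex.exp (Complex.I * φ) * (((Real.sqrt 2 : ℝ) : ℂ) / 2)] := by
  have h : 1 / Real.sqrt 2 = Real.sqrt 2 / 2 := by
    rw [div_eq_div_iff (by positivity) (by norm_num)]
    norm_num
  simp only [eqState, h]
  push_cast
  rfl

theorem exp_mul_star_exp (φ : ℝ) :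
    Complex.exp (Complex.I * φ) * star (Complex.exp (Complex.I * φ)) = 1 := by
  rw [Complex.star_def, ← Complex.exp_conj, ← Complex.exp_add]
  simp

/-- The phase-covariant 1→2 cloner: the Kraus operators satisfy the completeness
relation, and for every equatorial state each single-clone fidelity equals
`1/2 + √2/4`. -/
theorem phase_covariant_one_to_two_cloner :
    K₁ᴴ * K₁ + K₂ᴴ * K₂ = 1 ∧
    ∀ φ : ℝ,
      fid (eqState φ) (trB (Eout (eqState φ)))
          = ((1 / 2 + Real.sqrt 2 / 4 : ℝ) : ℂ) ∧
      fid (eqState φ) (trA (Eout (eqState φ)))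
          = ((1 / 2 + Real.sqrt 2 / 4 : ℝ) : ℂ) := by
  refine ⟨?_, fun φ => ?_⟩
  · have hc := ofReal_sqrt_two_sq
    ext i j
    fin_cases i <;> fin_cases j <;>
      simp [Matrix.mul_apply, Fintype.sum_prod_type, K₁_apply, K₂_apply] <;>
      linear_combination (1 / 4 : ℂ) * hc
  · have hc := ofReal_sqrt_two_sq
    have he := exp_mul_star_exp φ
    rw [eqState_eq]
    generalize Complex.exp (Complex.I * φ) = e at he ⊢
    rw [Complex.star_def] at he
    constructor <;>
    · have h2 : (starRingEnd ℂ) 2 = 2 := map_ofNat _ 2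
      simp [h2, fid, trA, trB, Eout, outer, Matrix.mul_apply, K₁_apply, K₂_apply]
      generalize (starRingEnd ℂ) e = f at he ⊢
      generalize ((Real.sqrt 2 : ℝ) : ℂ) = c at hc ⊢
      linear_combination
        c ^ 4 / 64 * (2 + 4 * c + (1 + c ^ 2) * (e * f + 1)) * he +
          ((c ^ 2 + 2) / 64 * (4 + 2 * c ^ 2 + 4 * c) + 1 / 8) * hc
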